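/- arXiv:2009.02592 — 2 statements merged into one kernel-verified Lean document; each statement's English description precedes it below -/
import Mathlib

section
/- Let K be a bounded subset of ℝ and T : K → K a map. If there exists a positive T^ℕ interval, then there exist a positive subinterval I of K and a positive integer n such that T^n x = x for all x ∈ I. -/
/-- An interval: a bounded, nonempty, connected (order-connected) subset of ℝ. -/
def IsRealInterval (I : Set ℝ) : Prop :=
  I.Nonempty ∧ Bornology.IsBounded I ∧ I.OrdConnected

/-- An interval has positive length iff it contains two distinct points. -/
def HasPositiveLength (I : Set ℝ) : Prop :=
  ∃ x ∈ I, ∃ y ∈ I, x < y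

/-- `T` restricted to `I` is a translation: `T x - x` is constant on `I`. -/
def IsTranslationOn (T : ℝ → ℝ) (I : Set ℝ) : Prop :=
  ∃ c : ℝ, ∀ x ∈ I, T x = x + c

/-- `I` is a `T^ℕ` interval: a subinterval of `K` which is a `T^m` interval
for every positive integer `m`. -/
def IsTNInterval (T : ℝ → ℝ) (K I : Set ℝ) : Prop :=
  I ⊆ K ∧ IsRealInterval I ∧ ∀ m : ℕ, 0 < m → IsTranslationOn (T^[m]) I

/-- The displacements of a nondegenerate compact interval translated by all iterates of `T`:
if two of them differ by at most the length of the interval, they have the same increments. -/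
lemma displacement_add_sub_eq {T : ℝ → ℝ} {c : ℕ → ℝ} {a b : ℝ} (hab : a < b)
    (hc : ∀ m, ∀ x ∈ Set.Icc a b, T^[m] x = x + c m) {m n : ℕ}
    (hmn : |c n - c m| ≤ b - a) (p : ℕ) :
    c (p + n) - c n = c (p + m) - c m := by
  obtain ⟨hlo, hhi⟩ := abs_le.mp hmn
  obtain ⟨x, hx, y, hy, hxy⟩ :
      ∃ x ∈ Set.Icc a b, ∃ y ∈ Set.Icc a b, x + c m = y + c n := by
    rcases le_total (c m) (c n) with h | h
    · exact ⟨a + (c n - c m), ⟨by linarith, by linarith⟩, a, ⟨le_rfl, hab.le⟩, by ring⟩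
    · exact ⟨a, ⟨le_rfl, hab.le⟩, a + (c m - c n), ⟨by linarith, by linarith⟩, by ring⟩
  have hT : T^[p + m] x = T^[p + n] y := by
    rw [Function.iterate_add_apply, Function.iterate_add_apply, hc m x hx, hc n y hy, hxy]
  rw [hc _ x hx, hc _ y hy] at hT
  linarith

/-- A bounded real sequence has two terms, of distinct indices, that are arbitrarily close. -/
lemma exists_pos_abs_sub_lt_of_bounded {c : ℕ → ℝ} {M : ℝ} (hM : ∀ m, |c m| ≤ M)
    {ε : ℝ} (hε : 0 < ε) : ∃ m p, 0 < p ∧ |c (p + m) - c m| < ε := by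
  obtain ⟨l, -, φ, hφ, hl⟩ := tendsto_subseq_of_bounded (Metric.isBounded_Icc (-M) M)
    (fun m => abs_le.mp (hM m))
  obtain ⟨N, hN⟩ := Metric.cauchySeq_iff'.mp hl.cauchySeq ε hε
  have hlt : φ N < φ (N + 1) := hφ N.lt_succ_self
  refine ⟨φ N, φ (N + 1) - φ N, by omega, ?_⟩
  rw [Nat.sub_add_cancel hlt.le]
  exact hN (N + 1) N.le_succ

/-- If all iterates of `T` translate a nondegenerate compact interval by bounded amounts,
then two of these translations coincide. -/
lemma exists_displacement_eq {T : ℝ → ℝ} {c : ℕ → ℝ} {a b M : ℝ} (hab : a < b)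
    (hc : ∀ m, ∀ x ∈ Set.Icc a b, T^[m] x = x + c m) (hM : ∀ m, |c m| ≤ M) :
    ∃ m p, 0 < p ∧ c (p + m) = c m := by
  obtain ⟨m, p, hp, hlt⟩ := exists_pos_abs_sub_lt_of_bounded hM (sub_pos.mpr hab)
  refine ⟨m, p, hp, ?_⟩
  have step : ∀ k : ℕ, c (p + (k * p + m)) - c (k * p + m) = c (p + m) - c m := by
    intro k
    induction k with
    | zero => simp
    | succ k ih =>
      rw [show (k + 1) * p + m = p + (k * p + m) by ring, ← ih]
      exact displacement_add_sub_eq hab hc (by rw [ih]; exact hlt.le) p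
  have arith : ∀ k : ℕ, c (k * p + m) = c m + k * (c (p + m) - c m) := by
    intro k
    induction k with
    | zero => simp
    | succ k ih =>
      have h := step k
      rw [show (k + 1) * p + m = p + (k * p + m) by ring]
      push_cast
      linarith
  by_contra hne
  have hpos : 0 < |c (p + m) - c m| := abs_pos.mpr (sub_ne_zero.mpr hne)
  obtain ⟨k, hk⟩ := exists_nat_gt (2 * M / |c (p + m) - c m|)
  rw [div_lt_iff₀ hpos] at hk
  have hle : |c (k * p + m) - c m| ≤ 2 * M := by
    linarith [abs_sub (c (k * p + m)) (c m), hM (k * p + m), hM m]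
  rw [arith k, add_sub_cancel_left, abs_mul, Nat.abs_cast] at hle
  linarith

/-- if there is a positive `T^ℕ` interval, then there are a positive
subinterval `I` of `K` and a positive integer `m` with `T^m x = x` for all `x ∈ I`. -/
theorem stmt3 (K : Set ℝ) (hK : Bornology.IsBounded K) (T : ℝ → ℝ)
    (hT : Set.MapsTo T K K)
    (hex : ∃ I : Set ℝ, IsTNInterval T K I ∧ HasPositiveLength I) :
    ∃ I : Set ℝ, I ⊆ K ∧ IsRealInterval I ∧ HasPositiveLength I ∧
      ∃ m : ℕ, 0 < m ∧ ∀ x ∈ I, T^[m] x = x := by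
  obtain ⟨I, ⟨hIK, ⟨-, -, hI⟩, hTI⟩, a, ha, b, hb, hab⟩ := hex
  have hsub : Set.Icc a b ⊆ I := hI.out ha hb
  have hex : ∀ m : ℕ, ∃ d : ℝ, ∀ x ∈ Set.Icc a b, T^[m] x = x + d := by
    intro m
    rcases m.eq_zero_or_pos with rfl | hm
    · exact ⟨0, fun x _ => by simp⟩
    · obtain ⟨d, hd⟩ := hTI m hm
      exact ⟨d, fun x hx => hd x (hsub hx)⟩
  choose c hc using hex
  have hmem : ∀ m, ∀ x ∈ Set.Icc a b, x + c m ∈ K := fun m x hx =>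
    hc m x hx ▸ hT.iterate m (hIK (hsub hx))
  have haI : a ∈ Set.Icc a b := ⟨le_rfl, hab.le⟩
  obtain ⟨R, hR⟩ := hK.exists_norm_le
  have hM : ∀ m, |c m| ≤ R + |a| := by
    intro m
    have h₁ : |a + c m| ≤ R := hR _ (hmem m a haI)
    have h₂ := abs_sub (a + c m) a
    rw [add_sub_cancel_left] at h₂
    linarith
  obtain ⟨m, p, hp, heq⟩ := exists_displacement_eq hab hc hM
  refine ⟨Set.Icc (a + c m) (b + c m), ?_, ⟨⟨a + c m, le_rfl, by linarith⟩,
    Metric.isBounded_Icc _ _, Set.ordConnected_Icc⟩,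
    ⟨a + c m, ⟨le_rfl, by linarith⟩, b + c m, ⟨by linarith, le_rfl⟩, by linarith⟩, p, hp, ?_⟩
  · rintro x ⟨h₁, h₂⟩
    simpa using hmem m (x - c m) ⟨by linarith, by linarith⟩
  · rintro x ⟨h₁, h₂⟩
    have hx : x - c m ∈ Set.Icc a b := ⟨by linarith, by linarith⟩
    have h := hc (p + m) _ hx
    rwa [Function.iterate_add_apply, hc m _ hx, heq, sub_add_cancel] at h
end

section
/- Let k be a positive integer and i_0, …, i_{k−1} ∈ {1,…,n}. Set I = ⋂_{p=0}^{k−1} T^{−p}(J_{i_p}) and Ĩ = ⋂_{p=0}^{k−1} T̃^{−p}(J̃_{i_p}). If either I or Ĩ is nonempty, then there exist a < b in [0,1] with I = [a,b) and Ĩ = (a,b]; for each p = 0, …, k the map T^p is a translation on I and T̃^p is a translation on Ĩ with the same translation constant; for each p = 0, …, k one has T^p = T̃^p on (a,b) and these maps are continuous there; and the endpoints satisfy a ∈ {0} ∪ ⋃_{p=0}^{k−1} T^{−p}(D) and b ∈ {1} ∪ ⋃_{p=0}^{k−1} T̃^{−p}(D). Moreover, as the sequence (i_0,…,i_{k−1})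 ranges over {1,…,n}^k, the nonempty intervals I form a partition of [0,1) into left-closed right-open intervals, and the corresponding Ĩ form a partition of (0,1] into left-open right-closed intervals. -/
open Set

noncomputable section

/-- `bpt a k = a_1 + ⋯ + a_k` (0-indexed: the sum of the first `k` entries of `a`);
these are the division points `b_k` of the interval exchange. -/
def bpt {n : ℕ} (a : Fin n → ℝ) (k : ℕ) : ℝ :=
  ∑ j ∈ Finset.univ.filter (fun j : Fin n => (j : ℕ) < k), a j

/-- The left-closed right-open interval `J_i = [b_{i-1}, b_i)` (0-indexed). -/
def Jint {n : ℕ} (a : Fin n → ℝ) (i : Fin n) : Set ℝ :=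
  Set.Ico (bpt a (i : ℕ)) (bpt a ((i : ℕ) + 1))

/-- The left-open right-closed interval `J̃_i = (b_{i-1}, b_i]` (0-indexed). -/
def Jtil {n : ℕ} (a : Fin n → ℝ) (i : Fin n) : Set ℝ :=
  Set.Ioc (bpt a (i : ℕ)) (bpt a ((i : ℕ) + 1))

/-- The permuted probability vector `a^τ`, with `a^τ_{τ(i)} = a_i`. -/
def aperm {n : ℕ} (a : Fin n → ℝ) (τ : Equiv.Perm (Fin n)) : Fin n → ℝ :=
  fun j => a (τ.symm j)

/-- The set `D = {b_1, …, b_{n-1}}` of interior division points. -/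
def Dset {n : ℕ} (a : Fin n → ℝ) : Set ℝ :=
  {x | ∃ k : ℕ, 0 < k ∧ k < n ∧ x = bpt a k}

/-- `a` is a positive probability vector. -/
def IsProbVec {n : ℕ} (a : Fin n → ℝ) : Prop :=
  (∀ i, 0 < a i) ∧ ∑ i, a i = 1

/-- `T` is the Lr `(a,τ)` interval exchange transformation: on each
`J_i = [b_{i-1}, b_i)` it is the translation `x ↦ x - b_{i-1} + b^τ_{τ(i)-1}`. -/
def IsLrIET {n : ℕ} (a : Fin n → ℝ) (τ : Equiv.Perm (Fin n)) (T : ℝ → ℝ) : Prop :=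
  ∀ i : Fin n, ∀ x ∈ Jint a i, T x = x - bpt a (i : ℕ) + bpt (aperm a τ) ((τ i : ℕ))

/-- `Tt` is the dual lR `(a,τ)` interval exchange transformation: on each
`J̃_i = (b_{i-1}, b_i]` it is the translation `x ↦ x - b_{i-1} + b^τ_{τ(i)-1}`. -/
def IslRIET {n : ℕ} (a : Fin n → ℝ) (τ : Equiv.Perm (Fin n)) (Tt : ℝ → ℝ) : Prop :=
  ∀ i : Fin n, ∀ x ∈ Jtil a i, Tt x = x - bpt a (i : ℕ) + bpt (aperm a τ) ((τ i : ℕ))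

/-- The Keane Condition: `D ∩ T^k(D) = ∅` for every positive integer `k`. -/
def KeaneCond {n : ℕ} (a : Fin n → ℝ) (T : ℝ → ℝ) : Prop :=
  ∀ k : ℕ, 0 < k → Dset a ∩ (T^[k] '' Dset a) = ∅

/-- `τ` is irreducible: `τ({1,…,j}) ≠ {1,…,j}` for `j = 1, …, n-1` (0-indexed:
no proper initial segment is invariant). -/
def IrreduciblePerm {n : ℕ} (τ : Equiv.Perm (Fin n)) : Prop :=
  ∀ j : ℕ, 0 < j → j < n →
    (fun i => τ i) '' {i : Fin n | (i : ℕ) < j} ≠ {i : Fin n | (i : ℕ) < j}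

/-- `P` is the family of ℤ-iterates of `T` on `[0,1)`: `P 0 = id`,
`P (k+1) = T ∘ P k`, and each `P k` maps `[0,1)` into itself. -/
def IsZIterLr (T : ℝ → ℝ) (P : ℤ → ℝ → ℝ) : Prop :=
  (∀ x ∈ Set.Ico (0 : ℝ) 1, P 0 x = x) ∧
  ∀ k : ℤ, ∀ x ∈ Set.Ico (0 : ℝ) 1, P k x ∈ Set.Ico (0 : ℝ) 1 ∧ P (k + 1) x = T (P k x)

/-- `Pt` is the family of ℤ-iterates of `Tt` on `(0,1]`. -/
def IsZIterlR (Tt : ℝ → ℝ) (Pt : ℤ → ℝ → ℝ) : Prop :=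
  (∀ x ∈ Set.Ioc (0 : ℝ) 1, Pt 0 x = x) ∧
  ∀ k : ℤ, ∀ x ∈ Set.Ioc (0 : ℝ) 1, Pt k x ∈ Set.Ioc (0 : ℝ) 1 ∧ Pt (k + 1) x = Tt (Pt k x)

/-- `I` is the itinerary map of `T` (with ℤ-iterates `P`):
`𝓘(x)_k = i ↔ T^k x ∈ J_i` for `x ∈ [0,1)`. -/
def IsItin {n : ℕ} (a : Fin n → ℝ) (P : ℤ → ℝ → ℝ) (I : ℝ → ℤ → Fin n) : Prop :=
  ∀ x ∈ Set.Ico (0 : ℝ) 1, ∀ k : ℤ, ∀ i : Fin n, (I x k = i ↔ P k x ∈ Jint a i)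

/-- `It` is the itinerary map of `Tt` (with ℤ-iterates `Pt`):
`𝓘̃(x)_k = i ↔ T̃^k x ∈ J̃_i` for `x ∈ (0,1]`. -/
def IsItinDual {n : ℕ} (a : Fin n → ℝ) (Pt : ℤ → ℝ → ℝ) (It : ℝ → ℤ → Fin n) : Prop :=
  ∀ x ∈ Set.Ioc (0 : ℝ) 1, ∀ k : ℤ, ∀ i : Fin n, (It x k = i ↔ Pt k x ∈ Jtil a i)

/-- `D_∞ = {0,1} ∪ ⋃_{k ∈ ℤ} T^k(D)`. -/
def Dinf {n : ℕ} (a : Fin n → ℝ) (P : ℤ → ℝ → ℝ) : Set ℝ :=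
  {0, 1} ∪ ⋃ k : ℤ, P k '' Dset a

/-- The set `R = [0,1] ∖ D_∞` of regular points. -/
def Rset {n : ℕ} (a : Fin n → ℝ) (P : ℤ → ℝ → ℝ) : Set ℝ :=
  Set.Icc 0 1 \ Dinf a P

/-- The shift `S` on `Ω = {1,…,n}^ℤ`: `S(α)_i = α_{i+1}`. -/
def shiftS {n : ℕ} (α : ℤ → Fin n) : ℤ → Fin n := fun i => α (i + 1)

/-- The `k`-th power of the shift: `(S^k α)_i = α_{i+k}`. -/
def shiftZ {n : ℕ} (k : ℤ) (α : ℤ → Fin n) : ℤ → Fin n := fun i => α (i + k)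

/-- `α, β` are positively asymptotic: `α_i = β_i` for all `i ≥ N`, some `N`. -/
def PosAsymp {n : ℕ} (α β : ℤ → Fin n) : Prop :=
  ∃ N : ℕ, ∀ i : ℤ, (N : ℤ) ≤ i → α i = β i

/-- `α, β` are negatively asymptotic: `α_i = β_i` for all `i ≤ -N`, some `N`. -/
def NegAsymp {n : ℕ} (α β : ℤ → Fin n) : Prop :=
  ∃ N : ℕ, ∀ i : ℤ, i ≤ -(N : ℤ) → α i = β i

theorem bpt_zero {n : ℕ} (a : Fin n → ℝ) : bpt a 0 = 0 := by
  simp [bpt]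

theorem bpt_succ {n : ℕ} (a : Fin n → ℝ) (i : Fin n) :
    bpt a ((i : ℕ) + 1) = bpt a (i : ℕ) + a i := by
  have h : Finset.univ.filter (fun j : Fin n => (j : ℕ) < (i : ℕ) + 1) =
      insert i (Finset.univ.filter (fun j : Fin n => (j : ℕ) < (i : ℕ))) := by
    ext j
    simp [Fin.ext_iff]
    omega
  rw [bpt, h, Finset.sum_insert (by simp), add_comm, bpt]

theorem bpt_card {n : ℕ} {a : Fin n → ℝ} (ha : IsProbVec a) : bpt a n = 1 := by
  simpa [bpt] using ha.2

theorem bpt_mono {n : ℕ} {a : Fin n → ℝ} (ha : IsProbVec a) : Monotone (bpt a) := by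
  intro k l hkl
  refine Finset.sum_le_sum_of_subset_of_nonneg ?_ fun i _ _ => (ha.1 i).le
  intro j
  simp only [Finset.mem_filter, Finset.mem_univ, true_and]
  omega

theorem bpt_nonneg {n : ℕ} {a : Fin n → ℝ} (ha : IsProbVec a) (k : ℕ) : 0 ≤ bpt a k :=
  (bpt_zero a).symm.trans_le (bpt_mono ha (Nat.zero_le k))

theorem bpt_succ_le_one {n : ℕ} {a : Fin n → ℝ} (ha : IsProbVec a) (i : Fin n) :
    bpt a ((i : ℕ) + 1) ≤ 1 :=
  (bpt_mono ha i.2).trans_eq (bpt_card ha)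

theorem IsProbVec.aperm {n : ℕ} {a : Fin n → ℝ} (ha : IsProbVec a) (τ : Equiv.Perm (Fin n)) :
    IsProbVec (aperm a τ) :=
  ⟨fun _ => ha.1 _, (Equiv.sum_comp τ.symm a).trans ha.2⟩

theorem bpt_aperm_succ {n : ℕ} (a : Fin n → ℝ) (τ : Equiv.Perm (Fin n)) (i : Fin n) :
    bpt (aperm a τ) ((τ i : ℕ) + 1) = bpt (aperm a τ) (τ i : ℕ) + a i := by
  simp [bpt_succ, aperm]

theorem exists_mem_Jint {n : ℕ} {a : Fin n → ℝ} (ha : IsProbVec a) {x : ℝ}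
    (hx : x ∈ Ico (0 : ℝ) 1) : ∃ i, x ∈ Jint a i := by
  have key : ∀ m ≤ n, x < bpt a m → ∃ i, x ∈ Jint a i := by
    intro m
    induction m with
    | zero => exact fun _ h => absurd hx.1 (by simpa [bpt_zero] using h)
    | succ m ih =>
      intro hm h
      rcases lt_or_ge x (bpt a m) with h' | h'
      · exact ih (by omega) h'
      · exact ⟨⟨m, hm⟩, h', h⟩
  exact key n le_rfl (by simpa [bpt_card ha] using hx.2)

theorem exists_mem_Jtil {n : ℕ} {a : Fin n → ℝ} (ha : IsProbVec a) {x : ℝ}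
    (hx : x ∈ Ioc (0 : ℝ) 1) : ∃ i, x ∈ Jtil a i := by
  have key : ∀ m ≤ n, x ≤ bpt a m → ∃ i, x ∈ Jtil a i := by
    intro m
    induction m with
    | zero => exact fun _ h => absurd hx.1 (by simpa [bpt_zero] using h)
    | succ m ih =>
      intro hm h
      rcases le_or_gt x (bpt a m) with h' | h'
      · exact ih (by omega) h'
      · exact ⟨⟨m, hm⟩, h', h⟩
  exact key n le_rfl (by simpa [bpt_card ha] using hx.2)

theorem eq_of_mem_Jint {n : ℕ} {a : Fin n → ℝ} (ha : IsProbVec a) {x : ℝ} {i j : Fin n}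
    (hi : x ∈ Jint a i) (hj : x ∈ Jint a j) : i = j := by
  by_contra h
  exact Set.disjoint_left.1
    ((bpt_mono ha).pairwise_disjoint_on_Ico_succ fun h' => h (Fin.ext h')) hi hj

theorem eq_of_mem_Jtil {n : ℕ} {a : Fin n → ℝ} (ha : IsProbVec a) {x : ℝ} {i j : Fin n}
    (hi : x ∈ Jtil a i) (hj : x ∈ Jtil a j) : i = j := by
  by_contra h
  exact Set.disjoint_left.1
    ((bpt_mono ha).pairwise_disjoint_on_Ioc_succ fun h' => h (Fin.ext h')) hi hj

theorem IsLrIET.mapsTo {n : ℕ} {a : Fin n → ℝ} {τ : Equiv.Perm (Fin n)} {T : ℝ → ℝ}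
    (hT : IsLrIET a τ T) (ha : IsProbVec a) : MapsTo T (Ico 0 1) (Ico 0 1) := by
  intro x hx
  obtain ⟨i, hi⟩ := exists_mem_Jint ha hx
  have h0 := bpt_nonneg (ha.aperm τ) (τ i)
  have h1 := bpt_succ_le_one (ha.aperm τ) (τ i)
  rw [bpt_aperm_succ] at h1
  have h2 := bpt_succ a i
  rw [hT i x hi]
  constructor <;> linarith [hi.1, hi.2]

theorem IslRIET.mapsTo {n : ℕ} {a : Fin n → ℝ} {τ : Equiv.Perm (Fin n)} {Tt : ℝ → ℝ}
    (hTt : IslRIET a τ Tt) (ha : IsProbVec a) : MapsTo Tt (Ioc 0 1) (Ioc 0 1) := by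
  intro x hx
  obtain ⟨i, hi⟩ := exists_mem_Jtil ha hx
  have h0 := bpt_nonneg (ha.aperm τ) (τ i)
  have h1 := bpt_succ_le_one (ha.aperm τ) (τ i)
  rw [bpt_aperm_succ] at h1
  have h2 := bpt_succ a i
  rw [hTt i x hi]
  constructor <;> linarith [hi.1, hi.2]

/-- An orbit of the Lr transformation reaches `0` only by starting there or through `D`. -/
theorem IsLrIET.eq_zero_or_mem_Dset {n : ℕ} {a : Fin n → ℝ} {τ : Equiv.Perm (Fin n)}
    {T : ℝ → ℝ} (hT : IsLrIET a τ T) (ha : IsProbVec a) {u : ℝ} (hu : u ∈ Ico (0 : ℝ) 1) :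
    ∀ p : ℕ, T^[p] u = 0 → u = 0 ∨ ∃ q < p, T^[q] u ∈ Dset a := by
  intro p
  induction p with
  | zero => exact Or.inl
  | succ p ih =>
    intro hp
    obtain ⟨i, hi⟩ := exists_mem_Jint ha ((hT.mapsTo ha).iterate p hu)
    rw [Function.iterate_succ_apply', hT i _ hi] at hp
    have hy : T^[p] u = bpt a i := by
      linarith [hi.1, bpt_nonneg (ha.aperm τ) (τ i)]
    rcases Nat.eq_zero_or_pos (i : ℕ) with h0 | h0
    · rcases ih (by rw [hy, h0, bpt_zero]) with h | ⟨q, hq, h⟩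
      · exact Or.inl h
      · exact Or.inr ⟨q, hq.trans (Nat.lt_succ_self p), h⟩
    · exact Or.inr ⟨p, Nat.lt_succ_self p, i, h0, i.2, hy⟩

/-- An orbit of the lR transformation reaches `1` only by starting there or through `D`. -/
theorem IslRIET.eq_one_or_mem_Dset {n : ℕ} {a : Fin n → ℝ} {τ : Equiv.Perm (Fin n)}
    {Tt : ℝ → ℝ} (hTt : IslRIET a τ Tt) (ha : IsProbVec a) {v : ℝ} (hv : v ∈ Ioc (0 : ℝ) 1) :
    ∀ p : ℕ, Tt^[p] v = 1 → v = 1 ∨ ∃ q < p, Tt^[q] v ∈ Dset a := by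
  intro p
  induction p with
  | zero => exact Or.inl
  | succ p ih =>
    intro hp
    obtain ⟨i, hi⟩ := exists_mem_Jtil ha ((hTt.mapsTo ha).iterate p hv)
    rw [Function.iterate_succ_apply', hTt i _ hi] at hp
    have h1 := bpt_succ_le_one (ha.aperm τ) (τ i)
    rw [bpt_aperm_succ] at h1
    have hy : Tt^[p] v = bpt a ((i : ℕ) + 1) := by
      linarith [hi.2, bpt_succ a i]
    rcases (Nat.succ_le_of_lt i.2).eq_or_lt with h0 | h0
    · rcases ih (by rw [hy, ← Nat.succ_eq_add_one, h0, bpt_card ha]) with h | ⟨q, hq, h⟩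
      · exact Or.inl h
      · exact Or.inr ⟨q, hq.trans (Nat.lt_succ_self p), h⟩
    · exact Or.inr ⟨p, Nat.lt_succ_self p, (i : ℕ) + 1, Nat.succ_pos _, h0, hy⟩

section PiecewiseTranslation

variable {ι : Type*} {F : ℝ → ℝ} {J : ι → Set ℝ} {c : ι → ℝ}

theorem iterate_eq_add_sum (hF : ∀ i, ∀ x ∈ J i, F x = x + c i) (s : ℕ → ι) {x : ℝ} {p : ℕ}
    (hx : ∀ q < p, F^[q] x ∈ J (s q)) : F^[p] x = x + ∑ q ∈ Finset.range p, c (s q) := by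
  induction p with
  | zero => simp
  | succ p ih =>
    rw [Function.iterate_succ_apply', hF _ _ (hx p p.lt_succ_self),
      ih fun q hq => hx q (hq.trans p.lt_succ_self), Finset.sum_range_succ, add_assoc]

theorem forall_iterate_mem_iff (hF : ∀ i, ∀ x ∈ J i, F x = x + c i) (s : ℕ → ι) (x : ℝ) (k : ℕ) :
    (∀ p < k, F^[p] x ∈ J (s p)) ↔
      ∀ p < k, x + ∑ q ∈ Finset.range p, c (s q) ∈ J (s p) := by
  constructor
  · intro h p hp
    rw [← iterate_eq_add_sum hF s fun q hq => h q (hq.trans hp)]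
    exact h p hp
  · intro h p
    induction p using Nat.strong_induction_on with
    | _ p ih =>
      intro hp
      rw [iterate_eq_add_sum hF s fun q hq => ih q hq (hq.trans hp)]
      exact h p hp

end PiecewiseTranslation

theorem existsUnique_itinerary {ι : Type*} {F : ℝ → ℝ} {J : ι → Set ℝ} {S : Set ℝ}
    (hF : MapsTo F S S) (hex : ∀ x ∈ S, ∃ i, x ∈ J i)
    (huniq : ∀ {x i j}, x ∈ J i → x ∈ J j → i = j) (k : ℕ) {x : ℝ} (hx : x ∈ S) :
    ∃! s : Fin k → ι, ∀ p : Fin k, F^[(p : ℕ)] x ∈ J (s p) := by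
  choose s hs using fun p : Fin k => hex _ (hF.iterate p hx)
  exact ⟨s, hs, fun t ht => funext fun p => huniq (ht p) (hs p)⟩

/-- Proposition 3.2: structure of the `k`-level partition intervals
`I = ⋂_{p<k} T^{-p}(J_{i_p})` and `Ĩ = ⋂_{p<k} T̃^{-p}(J̃_{i_p})`. -/
theorem stmt5 {n : ℕ} (hn : 2 ≤ n) (a : Fin n → ℝ) (ha : IsProbVec a)
    (τ : Equiv.Perm (Fin n)) (T Tt : ℝ → ℝ)
    (hT : IsLrIET a τ T) (hTt : IslRIET a τ Tt)
    (k : ℕ) (hk : 0 < k) (iseq : Fin k → Fin n) :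
    (({x : ℝ | ∀ p : Fin k, T^[(p : ℕ)] x ∈ Jint a (iseq p)}.Nonempty ∨
      {x : ℝ | ∀ p : Fin k, Tt^[(p : ℕ)] x ∈ Jtil a (iseq p)}.Nonempty) →
      ∃ u v : ℝ, u < v ∧ u ∈ Set.Icc (0 : ℝ) 1 ∧ v ∈ Set.Icc (0 : ℝ) 1 ∧
        {x : ℝ | ∀ p : Fin k, T^[(p : ℕ)] x ∈ Jint a (iseq p)} = Set.Ico u v ∧
        {x : ℝ | ∀ p : Fin k, Tt^[(p : ℕ)] x ∈ Jtil a (iseq p)} = Set.Ioc u v ∧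
        (∀ p ≤ k, ∃ c : ℝ, (∀ x ∈ Set.Ico u v, T^[p] x = x + c) ∧
          (∀ x ∈ Set.Ioc u v, Tt^[p] x = x + c)) ∧
        (∀ p ≤ k, (∀ x ∈ Set.Ioo u v, T^[p] x = Tt^[p] x) ∧
          ContinuousOn (T^[p]) (Set.Ioo u v) ∧ ContinuousOn (Tt^[p]) (Set.Ioo u v)) ∧
        (u = 0 ∨ ∃ p < k, T^[p] u ∈ Dset a) ∧
        (v = 1 ∨ ∃ p < k, Tt^[p] v ∈ Dset a)) ∧
    (∀ x ∈ Set.Ico (0 : ℝ) 1, ∃! s : Fin k → Fin n,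
      ∀ p : Fin k, T^[(p : ℕ)] x ∈ Jint a (s p)) ∧
    (∀ x ∈ Set.Ioc (0 : ℝ) 1, ∃! s : Fin k → Fin n,
      ∀ p : Fin k, Tt^[(p : ℕ)] x ∈ Jtil a (s p)) := by
  refine ⟨?_, fun x hx => existsUnique_itinerary (hT.mapsTo ha) (fun _ => exists_mem_Jint ha)
    (eq_of_mem_Jint ha) k hx, fun x hx => existsUnique_itinerary (hTt.mapsTo ha)
    (fun _ => exists_mem_Jtil ha) (eq_of_mem_Jtil ha) k hx⟩
  obtain ⟨s, rfl⟩ : ∃ s : ℕ → Fin n, iseq = fun p : Fin k => s p :=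
    ⟨fun q => if h : q < k then iseq ⟨q, h⟩ else iseq ⟨0, hk⟩, by ext p; simp⟩
  simp only [Fin.forall_iff]
  set c : Fin n → ℝ := fun i => bpt (aperm a τ) (τ i) - bpt a i with hc
  have hTc : ∀ i, ∀ x ∈ Jint a i, T x = x + c i := fun i x hx => by rw [hT i x hx, hc]; ring
  have hTtc : ∀ i, ∀ x ∈ Jtil a i, Tt x = x + c i := fun i x hx => by rw [hTt i x hx, hc]; ring
  set C : ℕ → ℝ := fun p => ∑ q ∈ Finset.range p, c (s q) with hC
  have hne : (Finset.range k).Nonempty := ⟨0, Finset.mem_range.2 hk⟩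
  set u := (Finset.range k).sup' hne fun p => bpt a (s p) - C p with hu
  set v := (Finset.range k).inf' hne fun p => bpt a ((s p : ℕ) + 1) - C p with hv
  have hI : {x : ℝ | ∀ p < k, T^[p] x ∈ Jint a (s p)} = Ico u v := by
    ext x
    rw [mem_ofPred_eq, forall_iterate_mem_iff hTc, mem_Ico, hu, hv, Finset.sup'_le_iff,
      Finset.lt_inf'_iff]
    simp only [Jint, mem_Ico, Finset.mem_range, sub_le_iff_le_add, lt_sub_iff_add_lt, hC,
      ← forall_and]
  have hIt : {x : ℝ | ∀ p < k, Tt^[p] x ∈ Jtil a (s p)} = Ioc u v := by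
    ext x
    rw [mem_ofPred_eq, forall_iterate_mem_iff hTtc, mem_Ioc, hu, hv, Finset.sup'_lt_iff,
      Finset.le_inf'_iff]
    simp only [Jtil, mem_Ioc, Finset.mem_range, sub_lt_iff_lt_add, le_sub_iff_add_le, hC,
      ← forall_and]
  rw [hI, hIt, nonempty_Ico, nonempty_Ioc, or_self]
  intro huv
  have memI : ∀ x ∈ Ico u v, ∀ p < k, T^[p] x ∈ Jint a (s p) := fun x hx => hI.ge hx
  have memIt : ∀ x ∈ Ioc u v, ∀ p < k, Tt^[p] x ∈ Jtil a (s p) := fun x hx => hIt.ge hx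
  have trI : ∀ p ≤ k, ∀ x ∈ Ico u v, T^[p] x = x + C p := fun p hp x hx =>
    iterate_eq_add_sum hTc s fun q hq => memI x hx q (hq.trans_le hp)
  have trIt : ∀ p ≤ k, ∀ x ∈ Ioc u v, Tt^[p] x = x + C p := fun p hp x hx =>
    iterate_eq_add_sum hTtc s fun q hq => memIt x hx q (hq.trans_le hp)
  have huI : u ∈ Ico u v := left_mem_Ico.2 huv
  have hvI : v ∈ Ioc u v := right_mem_Ioc.2 huv
  have hu01 : u ∈ Ico (0 : ℝ) 1 :=
    Ico_subset_Ico (bpt_nonneg ha _) (bpt_succ_le_one ha _) (memI u huI 0 hk)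
  have hv01 : v ∈ Ioc (0 : ℝ) 1 :=
    Ioc_subset_Ioc (bpt_nonneg ha _) (bpt_succ_le_one ha _) (memIt v hvI 0 hk)
  refine ⟨u, v, huv, Ico_subset_Icc_self hu01, Ioc_subset_Icc_self hv01, rfl, rfl,
    fun p hp => ⟨C p, trI p hp, trIt p hp⟩, fun p hp => ⟨fun x hx => ?_, ?_, ?_⟩, ?_, ?_⟩
  · rw [trI p hp x (Ioo_subset_Ico_self hx), trIt p hp x (Ioo_subset_Ioc_self hx)]
  · exact (by fun_prop : ContinuousOn (fun x : ℝ => x + C p) (Ioo u v)).congr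
      fun x hx => trI p hp x (Ioo_subset_Ico_self hx)
  · exact (by fun_prop : ContinuousOn (fun x : ℝ => x + C p) (Ioo u v)).congr
      fun x hx => trIt p hp x (Ioo_subset_Ioc_self hx)
  · obtain ⟨p, hp, hup⟩ := Finset.exists_mem_eq_sup' hne fun p => bpt a (s p) - C p
    rw [Finset.mem_range] at hp
    have hpu : T^[p] u = bpt a (s p) := by
      rw [trI p hp.le u huI]
      linarith
    rcases Nat.eq_zero_or_pos (s p : ℕ) with h0 | h0
    · rw [h0, bpt_zero] at hpu
      exact (hT.eq_zero_or_mem_Dset ha hu01 p hpu).imp_right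
        fun ⟨q, hq, h⟩ => ⟨q, hq.trans hp, h⟩
    · exact Or.inr ⟨p, hp, s p, h0, (s p).2, hpu⟩
  · obtain ⟨p, hp, hvp⟩ := Finset.exists_mem_eq_inf' hne fun p => bpt a ((s p : ℕ) + 1) - C p
    rw [Finset.mem_range] at hp
    have hpv : Tt^[p] v = bpt a ((s p : ℕ) + 1) := by
      rw [trIt p hp.le v hvI]
      linarith
    rcases (Nat.succ_le_of_lt (s p).2).eq_or_lt with h0 | h0
    · rw [← Nat.succ_eq_add_one, h0, bpt_card ha] at hpv
      exact (hTt.eq_one_or_mem_Dset ha hv01 p hpv).imp_right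
        fun ⟨q, hq, h⟩ => ⟨q, hq.trans hp, h⟩
    · exact Or.inr ⟨p, hp, (s p : ℕ) + 1, Nat.succ_pos _, h0, hpv⟩
end
end
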